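/- For a q-matroid M=(E,ρ) with cyclic flats Z(M), the rank function satisfies ρ(V) = min over Z∈Z(M) of ( ρ(Z) + dim((V+Z)/Z) ) for every subspace V ≤ E. -/

import Mathlib

open Submodule Module

namespace QM

variable (F : Type*) {E : Type*} [Field F] [AddCommGroup E] [Module F E]

/-- The rank axioms (R1)-(R3) of a q-matroid. -/
def IsRkFn (ρ : Submodule F E → ℕ) : Prop :=
  (∀ V : Submodule F E, ρ V ≤ finrank F V) ∧
  (∀ ⦃V W : Submodule F E⦄, V ≤ W → ρ V ≤ ρ W) ∧
  (∀ V W : Submodule F E, ρ (V ⊔ W) + ρ (V ⊓ W) ≤ ρ V + ρ W)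

variable {F}

/-- Independent spaces. -/
def Indep (ρ : Submodule F E → ℕ) (V : Submodule F E) : Prop := ρ V = finrank F V

/-- Circuits: dependent spaces all of whose proper subspaces are independent. -/
def IsCircuit (ρ : Submodule F E → ℕ) (C : Submodule F E) : Prop :=
  ¬ Indep ρ C ∧ ∀ D : Submodule F E, D < C → Indep ρ D

/-- Open spaces: sums of circuits. -/
def IsOpenSp (ρ : Submodule F E → ℕ) (V : Submodule F E) : Prop :=
  ∃ S : Set (Submodule F E), (∀ C ∈ S, IsCircuit ρ C) ∧ V = sSup S

/-- The cyclic core: the sum of all circuits contained in `V`. -/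
def cyc (ρ : Submodule F E → ℕ) (V : Submodule F E) : Submodule F E :=
  sSup {C : Submodule F E | IsCircuit ρ C ∧ C ≤ V}

/-- The closure operator: the sum of all `⟨x⟩` with `ρ(V + ⟨x⟩) = ρ V`. -/
def cl (ρ : Submodule F E → ℕ) (V : Submodule F E) : Submodule F E :=
  sSup {W : Submodule F E | ∃ x : E, ρ (V ⊔ span F {x}) = ρ V ∧ W = span F {x}}

/-- Flats. -/
def IsFlat (ρ : Submodule F E → ℕ) (V : Submodule F E) : Prop :=
  ∀ x : E, x ∉ V → ρ V < ρ (V ⊔ span F {x})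

/-- Cyclic flats. -/
def CyclicFlat (ρ : Submodule F E → ℕ) (V : Submodule F E) : Prop :=
  IsFlat ρ V ∧ IsOpenSp ρ V

end QM

namespace QM

section helpers

variable {F E : Type*} [Field F] [AddCommGroup E] [Module F E] [FiniteDimensional F E]

/-- relative complements -/
lemma exists_compl_in {A B : Submodule F E} (h : A ≤ B) :
    ∃ K : Submodule F E, A ⊔ K = B ∧ finrank F K + finrank F A = finrank F B ∧ A ⊓ K = ⊥ := by
  obtain ⟨K', hK⟩ := Submodule.exists_isCompl A
  have h1 : A ⊔ (K' ⊓ B) = B := by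
    rw [← sup_inf_assoc_of_le _ h, hK.sup_eq_top, top_inf_eq]
  have h2 : A ⊓ (K' ⊓ B) = ⊥ := by
    rw [← inf_assoc, hK.inf_eq_bot, bot_inf_eq]
  refine ⟨K' ⊓ B, h1, ?_, h2⟩
  have h3 := Submodule.finrank_sup_add_finrank_inf_eq A (K' ⊓ B)
  rw [h1, h2, finrank_bot] at h3
  omega

lemma rk_le_add {ρ : Submodule F E → ℕ} (hρ : IsRkFn F ρ) {A B : Submodule F E} (h : A ≤ B) :
    ρ B + finrank F A ≤ ρ A + finrank F B := by
  obtain ⟨K, h1, h2, -⟩ := exists_compl_in h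
  have h3 := hρ.2.2 A K
  have h4 := hρ.1 K
  rw [h1] at h3
  omega

/-- every dependent space contains a circuit -/
lemma exists_circuit {ρ : Submodule F E → ℕ} {A : Submodule F E} (h : ¬ Indep ρ A) :
    ∃ C ≤ A, IsCircuit ρ C := by
  induction A using WellFoundedLT.induction with
  | ind A ih =>
    by_cases hA : ∀ D : Submodule F E, D < A → Indep ρ D
    · exact ⟨A, le_rfl, h, hA⟩
    · push Not at hA
      obtain ⟨D, hD, hD'⟩ := hA
      obtain ⟨C, hC, hC'⟩ := ih D hD hD'
      exact ⟨C, hC.trans hD.le, hC'⟩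

/-- every space contains an independent space of the same rank -/
lemma exists_basis {ρ : Submodule F E → ℕ} (hρ : IsRkFn F ρ) (A : Submodule F E) :
    ∃ I ≤ A, Indep ρ I ∧ ρ I = ρ A := by
  induction A using WellFoundedLT.induction with
  | ind A ih =>
    by_cases hA : Indep ρ A
    · exact ⟨A, le_rfl, hA, rfl⟩
    obtain ⟨C, hCA, hC⟩ := exists_circuit hA
    have hC0 : C ≠ ⊥ := by
      rintro rfl
      apply hC.1
      have := hρ.1 ⊥
      rw [finrank_bot] at this
      unfold Indep
      rw [finrank_bot]
      omega
    obtain ⟨y, hy, hy0⟩ := Submodule.exists_mem_ne_zero_of_ne_bot hC0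
    have hyC : span F {y} ≤ C := by simpa [span_le] using hy
    obtain ⟨K, h1, h2, h3⟩ := exists_compl_in (hyC.trans hCA)
    have hyK : y ∉ K := by
      intro hK
      have : y ∈ span F {y} ⊓ K := ⟨mem_span_singleton_self y, hK⟩
      rw [h3] at this
      exact hy0 (by simpa using this)
    have hKA : K ≤ A := h1 ▸ le_sup_right
    have hlt : K < A := lt_of_le_of_ne hKA (fun e => hyK (e ▸ hCA hy))
    have hCK : C ⊔ K = A := le_antisymm (sup_le hCA hKA) (h1 ▸ sup_le_sup_right hyC K)
    have hD : Indep ρ (C ⊓ K) := hC.2 _ (lt_of_le_of_ne inf_le_left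
      (fun e => hyK ((inf_eq_left.1 e) hy)))
    have h4 := Submodule.finrank_sup_add_finrank_inf_eq C K
    have h5 := hρ.2.2 C K
    have h6 : ρ C < finrank F C := lt_of_le_of_ne (hρ.1 C) hC.1
    rw [finrank_span_singleton hy0] at h2
    unfold Indep at hD
    rw [hCK] at h4 h5
    have h7 := hρ.2.1 hKA
    obtain ⟨I, hI, hI', hI''⟩ := ih K hlt
    exact ⟨I, hI.trans hKA, hI', by omega⟩

lemma exists_hyper {A B : Submodule F E} (h : A < B) :
    ∃ H : Submodule F E, ∃ x ∈ B, A ≤ H ∧ H < B ∧ x ∉ H ∧ finrank F H + 1 = finrank F B := by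
  obtain ⟨x, hxB, hxA⟩ := SetLike.exists_of_lt h
  have hx0 : x ≠ 0 := fun e => hxA (e ▸ A.zero_mem)
  have hd : A ⊓ span F {x} = ⊥ := by
    rw [← disjoint_iff]
    exact (Submodule.disjoint_span_singleton' hx0).2 hxA
  have hle : A ⊔ span F {x} ≤ B := sup_le h.le (by simpa [span_le] using hxB)
  obtain ⟨K, h1, h2, h3⟩ := exists_compl_in hle
  have hHB : A ⊔ K ≤ B := sup_le h.le (h1 ▸ le_sup_right)
  have e1 := Submodule.finrank_sup_add_finrank_inf_eq A (span F {x})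
  rw [hd, finrank_bot, finrank_span_singleton hx0] at e1
  have e2 := Submodule.finrank_sup_add_finrank_inf_eq A K
  have e3 : A ⊓ K = ⊥ := le_bot_iff.1 (h3 ▸ inf_le_inf_right K le_sup_left)
  rw [e3, finrank_bot] at e2
  have e4 : finrank F ↥(A ⊔ K) + 1 = finrank F B := by omega
  refine ⟨A ⊔ K, x, hxB, le_sup_left, lt_of_le_of_ne hHB ?_, ?_, e4⟩
  · intro e
    rw [e] at e4
    omega
  · intro hx
    have : B ≤ A ⊔ K := by
      rw [← h1]
      exact sup_le (sup_le le_sup_left (by simpa [span_le] using hx)) le_sup_right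
    have := le_antisymm hHB this
    rw [this] at e4
    omega

/-- a space all of whose hyperplanes have full rank is open -/
lemma open_of_hyper {ρ : Submodule F E → ℕ} (hρ : IsRkFn F ρ) (Z : Submodule F E)
    (h : ∀ H < Z, finrank F H + 1 = finrank F Z → ρ Z ≤ ρ H) : IsOpenSp ρ Z := by
  refine ⟨{C | IsCircuit ρ C ∧ C ≤ Z}, fun C hC => hC.1, ?_⟩
  by_contra hne
  have hlt : sSup {C | IsCircuit ρ C ∧ C ≤ Z} < Z :=
    lt_of_le_of_ne (sSup_le fun C hC => hC.2) (Ne.symm hne)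
  obtain ⟨H, x, hxZ, hWH, hHZ, hxH, hdim⟩ := exists_hyper hlt
  have hr := h H hHZ hdim
  obtain ⟨I, hIH, hI, hIr⟩ := exists_basis hρ H
  have hx0 : x ≠ 0 := fun e => hxH (e ▸ H.zero_mem)
  have hdis : H ⊓ span F {x} = ⊥ := by
    rw [← disjoint_iff]
    exact (Submodule.disjoint_span_singleton' hx0).2 hxH
  have hdI : I ⊓ span F {x} = ⊥ := le_bot_iff.1 (hdis ▸ inf_le_inf_right _ hIH)
  have hJZ : I ⊔ span F {x} ≤ Z := sup_le (hIH.trans hHZ.le) (by simpa [span_le] using hxZ)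
  have e1 := Submodule.finrank_sup_add_finrank_inf_eq I (span F {x})
  rw [hdI, finrank_bot, finrank_span_singleton hx0] at e1
  have hJ : ¬ Indep ρ (I ⊔ span F {x}) := by
    intro hJ
    have := hρ.2.1 hJZ
    unfold Indep at hI hJ
    omega
  obtain ⟨C, hCJ, hC⟩ := exists_circuit hJ
  have hCH : C ≤ H := (le_sSup (show C ∈ {C | IsCircuit ρ C ∧ C ≤ Z} from
    ⟨hC, hCJ.trans hJZ⟩)).trans hWH
  have hCI : C ≤ I := by
    have : (I ⊔ span F {x}) ⊓ H = I := by
      rw [sup_inf_assoc_of_le _ hIH, inf_comm, hdis, sup_bot_eq]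
    exact this ▸ le_inf hCJ hCH
  have := rk_le_add hρ hCI
  have h6 : ρ C < finrank F C := lt_of_le_of_ne (hρ.1 C) hC.1
  unfold Indep at hI
  omega

lemma exists_opt {ρ : Submodule F E → ℕ} (hρ : IsRkFn F ρ) (V Z : Submodule F E)
    (hZ : ρ Z + finrank F ↥(V ⊔ Z) ≤ ρ V + finrank F Z) :
    ∃ Z' : Submodule F E, CyclicFlat ρ Z' ∧
      ρ Z' + finrank F ↥(V ⊔ Z') ≤ ρ V + finrank F Z' := by
  induction hm : 2 * ρ Z + (finrank F E - finrank F Z) using Nat.strong_induction_on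
    generalizing Z with
  | _ m ih =>
    by_cases hf : IsFlat ρ Z
    · by_cases ho : IsOpenSp ρ Z
      · exact ⟨Z, ⟨hf, ho⟩, hZ⟩
      · have := mt (open_of_hyper hρ Z) ho
        push Not at this
        obtain ⟨H, hHZ, hd, hr⟩ := this
        have a1 : finrank F ↥(V ⊔ H) ≤ finrank F ↥(V ⊔ Z) :=
          Submodule.finrank_mono (sup_le_sup_left hHZ.le V)
        have a2 := Submodule.finrank_le Z
        exact ih _ (by omega) H (by omega) rfl
    · unfold IsFlat at hf
      push Not at hf
      obtain ⟨x, hx, hr⟩ := hf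
      have hx0 : x ≠ 0 := fun e => hx (e ▸ Z.zero_mem)
      have hdis : Z ⊓ span F {x} = ⊥ := by
        rw [← disjoint_iff]
        exact (Submodule.disjoint_span_singleton' hx0).2 hx
      have e1 := Submodule.finrank_sup_add_finrank_inf_eq Z (span F {x})
      rw [hdis, finrank_bot, finrank_span_singleton hx0] at e1
      have e2 := Submodule.finrank_sup_add_finrank_inf_eq (V ⊔ Z) (span F {x})
      rw [finrank_span_singleton hx0, sup_assoc] at e2
      have a2 := Submodule.finrank_le (Z ⊔ span F {x})
      exact ih _ (by omega) (Z ⊔ span F {x}) (by omega) rfl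

end helpers

variable {F E : Type*} [Field F] [Fintype F] [AddCommGroup E] [Module F E]
  [FiniteDimensional F E]

theorem stmt10 (ρ : Submodule F E → ℕ) (hρ : IsRkFn F ρ) (V : Submodule F E) :
    ρ V = sInf {n : ℕ | ∃ Z : Submodule F E, CyclicFlat ρ Z ∧
      n = ρ Z + (finrank F ↥(V ⊔ Z) - finrank F Z)} := by
  have hlow : ∀ Z : Submodule F E, ρ V + finrank F Z ≤ ρ Z + finrank F ↥(V ⊔ Z) := by
    intro Z
    have h1 := rk_le_add hρ (le_sup_right : Z ≤ V ⊔ Z)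
    have h2 := hρ.2.1 (le_sup_left : V ≤ V ⊔ Z)
    omega
  have hmono : ∀ Z : Submodule F E, finrank F Z ≤ finrank F ↥(V ⊔ Z) :=
    fun Z => Submodule.finrank_mono le_sup_right
  obtain ⟨Z, hZ, hle⟩ := exists_opt hρ V V (by rw [sup_idem])
  symm
  apply IsLeast.csInf_eq
  constructor
  · refine ⟨Z, hZ, ?_⟩
    have := hlow Z
    have := hmono Z
    omega
  · rintro n ⟨Z', -, rfl⟩
    have := hlow Z'
    have := hmono Z'
    omega

end QM
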